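/- Let A = B·D be a real m×n matrix of full column rank, where D is an n×n diagonal matrix with positive diagonal entries. Let Ṽ be a real n×n orthogonal matrix and let ΔM̂ be a real n×n matrix with ‖D⁻¹ ΔM̂ D⁻¹‖ ≤ ε ‖B‖² for some ε ≥ 0. Then for all indices i, j ≤ n, |(Ṽᵀ ΔM̂ Ṽ)_{ij}| ≤ ε κ(B)² ‖A Ṽ(:,i)‖₂ · ‖A Ṽ(:,j)‖₂. -/

import Mathlib

open Matrix BigOperators

/-- Euclidean norm of a vector. -/
noncomputable def vnorm {k : ℕ} (v : Fin k → ℝ) : ℝ := Real.sqrt (∑ i, (v i)^2)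

/-- Spectral norm (operator 2-norm) of a real matrix. -/
noncomputable def spec {m n : ℕ} (A : Matrix (Fin m) (Fin n) ℝ) : ℝ :=
  ‖(Matrix.toEuclideanLin A).toContinuousLinearMap‖

/-- Moore–Penrose pseudoinverse of a full-column-rank matrix. -/
noncomputable def pinv {m n : ℕ} (A : Matrix (Fin m) (Fin n) ℝ) : Matrix (Fin n) (Fin m) ℝ :=
  (Aᵀ * A)⁻¹ * Aᵀ

/-- Condition number κ(B) = ‖B‖ ‖B†‖. -/
noncomputable def kappa {m n : ℕ} (B : Matrix (Fin m) (Fin n) ℝ) : ℝ :=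
  spec B * spec (pinv B)

theorem vnorm_eq_norm_toLp {k : ℕ} (v : Fin k → ℝ) : vnorm v = ‖WithLp.toLp 2 v‖ := by
  simp [vnorm, EuclideanSpace.norm_eq]

theorem vnorm_nonneg {k : ℕ} (v : Fin k → ℝ) : 0 ≤ vnorm v := Real.sqrt_nonneg _

theorem spec_nonneg {m n : ℕ} (A : Matrix (Fin m) (Fin n) ℝ) : 0 ≤ spec A := norm_nonneg _

theorem vnorm_mulVec_le {m n : ℕ} (A : Matrix (Fin m) (Fin n) ℝ) (v : Fin n → ℝ) :
    vnorm (A *ᵥ v) ≤ spec A * vnorm v := by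
  rw [vnorm_eq_norm_toLp, vnorm_eq_norm_toLp]
  exact (Matrix.toEuclideanLin A).toContinuousLinearMap.le_opNorm (WithLp.toLp 2 v)

theorem abs_dotProduct_le_vnorm_mul_vnorm {k : ℕ} (v w : Fin k → ℝ) :
    |v ⬝ᵥ w| ≤ vnorm v * vnorm w := by
  have h := abs_real_inner_le_norm (WithLp.toLp 2 w) (WithLp.toLp 2 v)
  rw [EuclideanSpace.inner_toLp_toLp] at h
  rw [vnorm_eq_norm_toLp, vnorm_eq_norm_toLp, mul_comm]
  simpa using h

theorem abs_dotProduct_mulVec_le {m n : ℕ} (N : Matrix (Fin m) (Fin n) ℝ)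
    (x : Fin m → ℝ) (y : Fin n → ℝ) :
    |x ⬝ᵥ N *ᵥ y| ≤ spec N * (vnorm x * vnorm y) :=
  calc |x ⬝ᵥ N *ᵥ y| ≤ vnorm x * vnorm (N *ᵥ y) := abs_dotProduct_le_vnorm_mul_vnorm _ _
    _ ≤ vnorm x * (spec N * vnorm y) :=
      mul_le_mul_of_nonneg_left (vnorm_mulVec_le N y) (vnorm_nonneg x)
    _ = spec N * (vnorm x * vnorm y) := by ring

theorem pinv_mul_self {m n : ℕ} {B : Matrix (Fin m) (Fin n) ℝ} (hB : B.rank = n) :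
    pinv B * B = 1 := by
  have hrank : (Bᵀ * B).rank = Fintype.card (Fin n) := by
    rw [Matrix.rank_transpose_mul_self, hB, Fintype.card_fin]
  have hunit : IsUnit (Bᵀ * B) := by
    rw [← Matrix.mulVec_surjective_iff_isUnit]
    change Function.Surjective (Bᵀ * B).mulVecLin
    rw [← LinearMap.range_eq_top]
    apply Submodule.eq_top_of_finrank_eq
    rw [Module.finrank_fintype_fun_eq_card]
    exact hrank
  rw [pinv, Matrix.mul_assoc]
  exact Matrix.nonsing_inv_mul _ ((Matrix.isUnit_iff_isUnit_det _).mp hunit)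

/-- bound on |(Ṽᵀ ΔM̂ Ṽ)_{ij}|. -/
theorem stmt_3 {m n : ℕ} (A B : Matrix (Fin m) (Fin n) ℝ)
    (d : Fin n → ℝ) (hd : ∀ i, 0 < d i)
    (hA : A = B * Matrix.diagonal d) (hrank : A.rank = n)
    (V : Matrix (Fin n) (Fin n) ℝ) (hV : Vᵀ * V = 1)
    (ΔMh : Matrix (Fin n) (Fin n) ℝ) (ε : ℝ) (hε : 0 ≤ ε)
    (hΔMh : spec (Matrix.diagonal (fun i => (d i)⁻¹) * ΔMh *
      Matrix.diagonal (fun i => (d i)⁻¹)) ≤ ε * spec B ^ 2) :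
    ∀ i j, |(Vᵀ * ΔMh * V) i j| ≤ ε * kappa B ^ 2 *
      (vnorm (fun k => (A * V) k i) * vnorm (fun k => (A * V) k j)) := by
  have hB : B.rank = n := by
    refine le_antisymm B.rank_le_width (hrank.ge.trans ?_)
    rw [hA]
    exact Matrix.rank_mul_le_left _ _
  set D := Matrix.diagonal d
  set E := Matrix.diagonal fun i => (d i)⁻¹
  have hED : E * D = 1 := by
    simp [E, D, Matrix.diagonal_mul_diagonal, (hd _).ne']
  have hDE : D * E = 1 := mul_eq_one_comm.mp hED
  have hM : D * (E * ΔMh * E) * D = ΔMh := by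
    calc D * (E * ΔMh * E) * D = (D * E) * ΔMh * (E * D) := by simp only [Matrix.mul_assoc]
      _ = ΔMh := by rw [hDE, hED, Matrix.one_mul, Matrix.mul_one]
  have hcol (i : Fin n) : vnorm ((D * V).col i) ≤ spec (pinv B) * vnorm ((A * V).col i) := by
    have h : (D * V).col i = pinv B *ᵥ (A * V).col i := by
      change _ = (pinv B * (A * V)).col i
      rw [hA, Matrix.mul_assoc, ← Matrix.mul_assoc, pinv_mul_self hB, Matrix.one_mul]
    rw [h]
    exact vnorm_mulVec_le _ _
  intro i j
  have hentry : (Vᵀ * ΔMh * V) i j =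
      (D * V).col i ⬝ᵥ (E * ΔMh * E) *ᵥ (D * V).col j := by
    have h : Vᵀ * ΔMh * V = (D * V)ᵀ * ((E * ΔMh * E) * (D * V)) := by
      conv_lhs => rw [← hM]
      simp only [Matrix.transpose_mul, D, Matrix.diagonal_transpose, Matrix.mul_assoc]
    rw [h]
    rfl
  have hbound : 0 ≤ ε * spec B ^ 2 := by positivity
  rw [hentry]
  calc _ ≤ spec (E * ΔMh * E) * (vnorm ((D * V).col i) * vnorm ((D * V).col j)) :=
        abs_dotProduct_mulVec_le _ _ _
    _ ≤ (ε * spec B ^ 2) * ((spec (pinv B) * vnorm ((A * V).col i)) *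
          (spec (pinv B) * vnorm ((A * V).col j))) :=
        mul_le_mul hΔMh
          (mul_le_mul (hcol i) (hcol j) (vnorm_nonneg _)
            (mul_nonneg (spec_nonneg _) (vnorm_nonneg _)))
          (mul_nonneg (vnorm_nonneg _) (vnorm_nonneg _)) hbound
    _ = ε * kappa B ^ 2 * (vnorm ((A * V).col i) * vnorm ((A * V).col j)) := by
        rw [kappa]
        ring
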